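/- arXiv:1006.2442 — 2 statements merged into one kernel-verified Lean document; each statement's English description precedes it below -/
import Mathlib

section
/- Let F be a field of characteristic p > 0 and H a finite subgroup of GL_n(F) whose order is prime to p. Then H has an abelian normal subgroup of index at most d(n), where d(n) is a Jordan bound valid for finite subgroups of GL_n(ℂ). -/
theorem jl_step {R A H : Type*} [CommRing R] [Ring A] [Algebra R A] [Group H] [Fintype H]
    (u : R) (hu : u * (Fintype.card H : R) = 1) (π : R) (f : H → A) (h1 : f 1 = 1)
    (c : H → H → A) (hc : ∀ g h, f g * f h = f (g * h) + π • c g h) :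
    ∃ b : H → A, b 1 = 0 ∧ ∃ c' : H → H → A, ∀ g h,
      (f g - b g) * (f h - b h) = (f (g * h) - b (g * h)) + π ^ 2 • c' g h ∧
      ∃ b' : H → A, ∀ g, b g = π • b' g := by
  set C : H → H → A := fun g h => f g * f h - f (g * h) with hC
  have hCc : ∀ g h, C g h = π • c g h := fun g h => by simp [hC, hc]
  set b' : H → A := fun g => u • ∑ k, c g k * f k⁻¹ with hb'
  set b : H → A := fun g => u • ∑ k, C g k * f k⁻¹ with hb
  have hbb : ∀ g, b g = π • b' g := by
    intro g
    simp only [hb, hb', hCc, smul_mul_assoc, ← Finset.smul_sum]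
    rw [smul_comm]
  refine ⟨b, by simp [hb, hC, h1], fun g h => b' g * b' h - u • ∑ k, c g h * c k k⁻¹
    - u • ∑ k, c g k * c k⁻¹ h, fun g h => ⟨?_, b', hbb⟩⟩
  have e1 : π ^ 2 • (b' g * b' h - u • ∑ k, c g h * c k k⁻¹ - u • ∑ k, c g k * c k⁻¹ h)
      = b g * b h - u • ∑ k, C g h * C k k⁻¹ - u • ∑ k, C g k * C k⁻¹ h := by
    simp only [hbb, hCc, smul_mul_smul_comm, ← Finset.smul_sum, smul_sub, ← pow_two]
    rw [smul_comm u, smul_comm u]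
  have e2 : C g h = u • ∑ _k : H, C g h := by
    rw [Finset.sum_const, Finset.card_univ, ← Nat.cast_smul_eq_nsmul R, smul_smul, hu, one_smul]
  have e3 : ∑ k, C g (h * k) * f k⁻¹ = ∑ k, C g k * f (k⁻¹ * h) := by
    rw [← Equiv.sum_comp (Equiv.mulLeft h) (fun k => C g k * f (k⁻¹ * h))]
    simp
  have e4 : f g * b h + b g * f h - b (g * h) - C g h
      = u • ∑ k, C g h * C k k⁻¹ + u • ∑ k, C g k * C k⁻¹ h := by
    have : ∑ k, (f g * (C h k * f k⁻¹)) + ∑ k, C g k * f k⁻¹ * f h - ∑ k, C (g * h) k * f k⁻¹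
       - ∑ _k : H, C g h = ∑ k, C g h * C k k⁻¹ + ∑ k, C g k * C k⁻¹ h + 
        (∑ k, C g k * f (k⁻¹ * h) - ∑ k, C g (h * k) * f k⁻¹) := by
      simp only [← Finset.sum_add_distrib, ← Finset.sum_sub_distrib]
      refine Finset.sum_congr rfl fun k _ => ?_
      simp only [hC, mul_assoc, mul_inv_cancel, h1]
      noncomm_ring
    rw [e3, sub_self, add_zero] at this
    conv_lhs => rw [e2]
    simp only [hb, mul_smul_comm, smul_mul_assoc, ← smul_add, ← smul_sub, Finset.mul_sum,
      Finset.sum_mul, this]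
  rw [e1]
  have e5 : f g * f h = f (g * h) + C g h := by simp [hC]
  have e6 : C g h = f g * b h + b g * f h - b (g * h) - (u • ∑ k, C g h * C k k⁻¹ + u • ∑ k, C g k * C k⁻¹ h) := by
    rw [← e4]; abel
  rw [sub_mul, mul_sub, mul_sub, e5]
  generalize (u • ∑ k, C g h * C k k⁻¹) = X at *
  generalize (u • ∑ k, C g k * C k⁻¹ h) = Y at *
  rw [e6]; abel

open Matrix in
theorem jl_lift {R H : Type*} [CommRing R] [Group H] [Fintype H] (n : ℕ) (π : R)
    [IsAdicComplete (Ideal.span {π}) R]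
    (u : R) (hu : u * (Fintype.card H : R) = 1) (f : H → Matrix (Fin n) (Fin n) R) (h1 : f 1 = 1)
    (hf : ∀ g h i j, π ∣ (f g * f h - f (g * h)) i j) :
    ∃ L : H →* Matrix (Fin n) (Fin n) R, ∀ g i j, π ∣ (L g - f g) i j := by
  let P : ℕ → (H → Matrix (Fin n) (Fin n) R) → Prop := fun k f =>
    f 1 = 1 ∧ ∃ c : H → H → Matrix (Fin n) (Fin n) R, 
      ∀ g h, f g * f h = f (g * h) + π ^ (k+1) • c g h
  have step : ∀ k f, P k f → ∃ f', P (k+1) f' ∧ ∀ g i j, π ^ (k+1) ∣ (f' g - f g) i j := by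
    rintro k f ⟨h1, c, hc⟩
    obtain ⟨b, hb1, c', h⟩ := jl_step u hu (π ^ (k+1)) f h1 c hc
    obtain ⟨b', hb'⟩ := (h 1 1).2
    refine ⟨fun g => f g - b g, ⟨by simp [h1, hb1], fun g h => π ^ k • c' g h, fun g h' => ?_⟩, ?_⟩
    · rw [(h g h').1, smul_smul]; congr 2; ring
    · intro g i j
      simp [hb']
  choose! F hF1 hF2 using step
  have h0 : P 0 f := by
    choose c hc using hf
    refine ⟨h1, fun g h => Matrix.of (c g h), fun g h => ?_⟩
    ext i j
    have := hc g h i j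
    simp only [Matrix.sub_apply] at this
    simp [← this]
  let s : ℕ → (H → Matrix (Fin n) (Fin n) R) := fun k => Nat.rec f (fun k f => F k f) k
  have hsP : ∀ k, P k (s k) := fun k => by
    induction k with
    | zero => exact h0
    | succ k ih => exact hF1 k _ ih
  have hsd : ∀ k g i j, π ^ (k+1) ∣ (s (k+1) g - s k g) i j := fun k => hF2 k _ (hsP k)
  have hsd' : ∀ m k g i j, m ≤ k → π ^ (m+1) ∣ (s k g - s m g) i j := by
    intro m k g i j hmk
    induction k, hmk using Nat.le_induction with
    | base => simp
    | succ k hk ih =>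
      have := dvd_add ((pow_dvd_pow π (by omega : m + 1 ≤ k + 1)).trans (hsd k g i j)) ih
      simpa using this
  have lim : ∀ g i j, ∃ l : R, ∀ k, π ^ k ∣ l - s k g i j := by
    intro g i j
    obtain ⟨l, hl⟩ := IsPrecomplete.prec' (I := Ideal.span {π}) (fun k => s k g i j) (by
      intro m k hmk
      simp only [Ideal.span_singleton_pow, smul_eq_mul, Ideal.mul_top, SModEq.sub_mem,
        Ideal.mem_span_singleton]
      have := (pow_dvd_pow π (Nat.le_succ m)).trans (hsd' m k g i j hmk)
      rw [← dvd_neg]; simpa using this)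
    refine ⟨l, fun k => ?_⟩
    have := hl k
    simp only [Ideal.span_singleton_pow, smul_eq_mul, Ideal.mul_top, SModEq.sub_mem,
        Ideal.mem_span_singleton] at this
    rw [← dvd_neg]; simpa using this
  choose l hl using lim
  have haus : ∀ x : R, (∀ k, π ^ k ∣ x) → x = 0 := by
    intro x hx
    refine IsHausdorff.haus' (I := Ideal.span {π}) x fun k => ?_
    simpa only [Ideal.span_singleton_pow, smul_eq_mul, Ideal.mul_top, SModEq.zero,
        Ideal.mem_span_singleton] using hx k
  have hl' : ∀ k g, ∃ e : Matrix (Fin n) (Fin n) R, Matrix.of (l g) = s k g + π ^ k • e := by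
    intro k g
    choose e he using fun i j => hl g i j k
    refine ⟨Matrix.of e, ?_⟩
    ext i j
    simp [← he]
  refine ⟨{ toFun := fun g => Matrix.of (l g), map_one' := ?_, map_mul' := fun g h => ?_ }, ?_⟩
  · ext i j
    rw [← sub_eq_zero]
    refine haus _ fun k => ?_
    have := hl 1 i j k
    rwa [(hsP k).1] at this
  · ext i j
    rw [← sub_eq_zero]
    refine haus _ fun k => ?_
    obtain ⟨e1, he1⟩ := hl' k g
    obtain ⟨e2, he2⟩ := hl' k h
    obtain ⟨e3, he3⟩ := hl' k (g * h)
    obtain ⟨c, hc⟩ := (hsP k).2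
    have : Matrix.of (l (g * h)) - Matrix.of (l g) * Matrix.of (l h)
      = π ^ k • (e3 - π • c g h - s k g * e2 - e1 * s k h - π ^ k • (e1 * e2)) := by
      rw [he1, he2, he3, add_mul, mul_add, mul_add, hc, pow_succ]
      simp only [smul_sub, smul_smul, smul_mul_assoc, mul_smul_comm]
      abel
    have := congrFun (congrFun this i) j
    rw [Matrix.sub_apply] at this
    rw [this]
    simp
  · intro g i j
    have h1 := hl g i j 1
    have h2 := hsd 0 g i j
    rw [zero_add] at h2
    have := dvd_add h1 h2
    rw [pow_one] at this
    have e : s 0 = f := rfl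
    simpa [e] using this

open Cardinal in
theorem jl_embed (R : Type*) [CommRing R] [IsDomain R] [CharZero R] [Countable R] :
    ∃ φ : R →+* ℂ, Function.Injective φ := by
  let M := MvPolynomial ℝ R
  let K := FractionRing M
  let Ω := AlgebraicClosure K
  have hM : #M = 𝔠 := by
    rw [MvPolynomial.cardinalMk_eq_max_lift]
    simp [Cardinal.mk_real, aleph0_le_continuum]
  have hK : #K = 𝔠 := by rw [← hM]; exact IsFractionRing.cardinalMk M K
  have hΩ : #Ω = 𝔠 := by
    apply le_antisymm
    · refine (Algebra.IsAlgebraic.cardinalMk_le_max K Ω).trans ?_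
      simp [hK, aleph0_le_continuum]
    · rw [← hK]
      exact mk_le_of_injective (algebraMap K Ω).injective
  have inj1 : Function.Injective (algebraMap R M) := MvPolynomial.C_injective _ _
  have inj2 : Function.Injective (algebraMap M K) := IsFractionRing.injective M K
  let ψ : R →+* Ω := (algebraMap K Ω).comp ((algebraMap M K).comp (algebraMap R M))
  have hψ : Function.Injective ψ := (algebraMap K Ω).injective.comp (inj2.comp inj1)
  have : CharZero Ω := charZero_of_injective_ringHom hψ
  obtain ⟨e⟩ : Nonempty (Ω ≃+* ℂ) := by
    refine IsAlgClosed.ringEquiv_of_equiv_of_charZero ?_ ?_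
    · rw [hΩ]; exact aleph0_lt_continuum
    · rw [← lift_mk_eq', hΩ, mk_complex]; simp
  exact ⟨(e : Ω →+* ℂ).comp ψ, e.injective.comp hψ⟩

theorem jl_charZero (p : ℕ) [hp : Fact p.Prime] (k : Type*) [Field k] [CharP k p] :
    CharZero (WittVector p k) := by
  obtain ⟨q, hq⟩ := CharP.exists (WittVector p k)
  rcases CharP.char_is_prime_or_zero (WittVector p k) q with h | h
  · exfalso
    have h0 : ((q : ℕ) : WittVector p k) = 0 := CharP.cast_eq_zero _ q
    have h1 := congrArg (WittVector.constantCoeff (p := p) (R := k)) h0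
    rw [map_natCast, map_zero, CharP.cast_eq_zero_iff k p] at h1
    have := (Nat.prime_dvd_prime_iff_eq hp.out h).1 h1
    subst this
    exact WittVector.p_nonzero _ _ h0
  · subst h
    exact CharP.charP_to_charZero _

theorem jl_toComplex {W H : Type*} [CommRing W] [IsDomain W] [CharZero W] [Group H] [Finite H]
    (n : ℕ) (L : H →* Matrix (Fin n) (Fin n) W) (hL : Function.Injective L) :
    ∃ ρ : H →* Matrix.GeneralLinearGroup (Fin n) ℂ, Function.Injective ρ := by
  let S : Set W := Set.range (fun x : H × Fin n × Fin n => L x.1 x.2.1 x.2.2)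
  let R := Algebra.adjoin ℤ S
  have hS : S.Countable := Set.countable_range _
  have : Countable R := by
    rw [← Cardinal.mk_le_aleph0_iff]
    have h := Algebra.lift_cardinalMk_adjoin_le ℤ S
    rw [Cardinal.lift_uzero] at h
    refine h.trans ?_
    simpa using hS
  have hmem : ∀ g i j, L g i j ∈ R := fun g i j => Algebra.subset_adjoin ⟨(g, i, j), rfl⟩
  have : CharZero R := charZero_of_injective_ringHom (f := Int.castRingHom R) (by
    intro a b h
    have := congrArg (Subtype.val) h
    simpa using this)
  obtain ⟨φ, hφ⟩ := jl_embed R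
  let inc : Matrix (Fin n) (Fin n) R →+* Matrix (Fin n) (Fin n) W := R.val.toRingHom.mapMatrix
  have hinc : Function.Injective inc := Matrix.map_injective Subtype.val_injective
  let L0 : H → Matrix (Fin n) (Fin n) R := fun g => Matrix.of fun i j => ⟨L g i j, hmem g i j⟩
  have hL0 : ∀ g, inc (L0 g) = L g := fun g => rfl
  let L1 : H →* Matrix (Fin n) (Fin n) R :=
    { toFun := L0
      map_one' := hinc (by rw [hL0, map_one, map_one])
      map_mul' := fun g h => hinc (by rw [map_mul, hL0, hL0, hL0, map_mul]) }
  have hL1 : Function.Injective L1 := fun g h e => hL (by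
    rw [← hL0, ← hL0]; exact congrArg inc e)
  let L2 : H →* Matrix (Fin n) (Fin n) ℂ := (φ.mapMatrix : _ →+* _).toMonoidHom.comp L1
  have hL2 : Function.Injective L2 := (Matrix.map_injective hφ).comp hL1
  refine ⟨L2.toHomUnits, fun g h e => hL2 ?_⟩
  exact congrArg Units.val e

theorem jl_witt (n : ℕ) (F : Type*) [Field F] (p : ℕ) [hp : Fact p.Prime] [CharP F p]
    (H : Subgroup (Matrix.GeneralLinearGroup (Fin n) F)) [Finite H]
    (hord : ¬ p ∣ Nat.card H) :
    ∃ L : H →* Matrix (Fin n) (Fin n) (WittVector p (AlgebraicClosure F)),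
      Function.Injective L := by
  classical
  have := Fintype.ofFinite H
  let k := AlgebraicClosure F
  have : CharP k p := charP_of_injective_algebraMap (algebraMap F k).injective p
  have : PerfectRing k p := PerfectField.toPerfectRing p
  let W := WittVector p k
  let cc : W →+* k := WittVector.constantCoeff
  let s : k → W := fun x => WittVector.teichmuller p x
  have hs : ∀ x, cc (s x) = x := fun x => WittVector.teichmuller_coeff_zero p x
  have hdvd : ∀ x : W, (p : W) ∣ x ↔ cc x = 0 := fun x => by
    rw [← Ideal.mem_span_singleton]
    exact WittVector.mem_span_p_iff_coeff_zero_eq_zero x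
  obtain ⟨u, hu⟩ : ∃ u : W, u * (Fintype.card H : W) = 1 := by
    have : IsUnit (Fintype.card H : W) := by
      apply WittVector.isUnit_of_coeff_zero_ne_zero
      change cc _ ≠ 0
      rw [map_natCast, Ne, CharP.cast_eq_zero_iff k p]
      rwa [Nat.card_eq_fintype_card] at hord
    exact this.exists_left_inv
  let ι : Matrix (Fin n) (Fin n) F →+* Matrix (Fin n) (Fin n) k := (algebraMap F k).mapMatrix
  have hι : Function.Injective ι := Matrix.map_injective (algebraMap F k).injective
  let r : H → Matrix (Fin n) (Fin n) k := fun g => ι (g : Matrix.GeneralLinearGroup (Fin n) F).val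
  have hr : Function.Injective r := fun g h e => Subtype.ext (Units.ext (hι e))
  let f : H → Matrix (Fin n) (Fin n) W := fun g =>
    if g = 1 then 1 else (r g).map s
  have hf : ∀ g, cc.mapMatrix (f g) = r g := by
    intro g
    by_cases hg : g = 1
    · simp [f, hg, r]
    · simp only [f, hg, if_false]
      ext i j
      exact hs _
  have hmat : ∀ A : Matrix (Fin n) (Fin n) W, cc.mapMatrix A = 0 ↔ ∀ i j, (p : W) ∣ A i j := by
    intro A
    simp only [hdvd]
    exact ⟨fun h i j => congrFun (congrFun h i) j, fun h => by ext i j; exact h i j⟩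
  obtain ⟨L, hL⟩ := jl_lift n (p : W) u hu f (by simp [f]) (by
    intro g h
    rw [← hmat, map_sub, map_mul, hf, hf, hf]
    simp [r])
  refine ⟨L, fun g h e => hr ?_⟩
  have key : ∀ g, cc.mapMatrix (L g) = r g := fun g => by
    have := (hmat _).2 (hL g)
    rwa [map_sub, hf, sub_eq_zero] at this
  rw [← key, ← key, e]

/-- Case 5.2.2 of Serre's Theorem 3′: let `d` be a Jordan bound for `GL_n(ℂ)`.
If `F` has characteristic `p > 0` and `H ≤ GL_n(F)` is finite of order prime to `p`,
then `H` has an abelian normal subgroup of index at most `d`. -/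
theorem stmt_8 (n : ℕ) (d : ℕ)
    (hJordan : ∀ K : Subgroup (Matrix.GeneralLinearGroup (Fin n) ℂ), Finite K →
      ∃ A : Subgroup K, A.Normal ∧ (∀ x ∈ A, ∀ y ∈ A, x * y = y * x) ∧ A.index ≤ d)
    (F : Type*) [Field F] (p : ℕ) (hp : p.Prime) [CharP F p]
    (H : Subgroup (Matrix.GeneralLinearGroup (Fin n) F)) [Finite H]
    (hord : ¬ p ∣ Nat.card H) :
    ∃ A : Subgroup H, A.Normal ∧ (∀ x ∈ A, ∀ y ∈ A, x * y = y * x) ∧ A.index ≤ d := by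
  have : Fact p.Prime := ⟨hp⟩
  have : CharP (AlgebraicClosure F) p :=
    charP_of_injective_algebraMap (algebraMap F (AlgebraicClosure F)).injective p
  have : CharZero (WittVector p (AlgebraicClosure F)) := jl_charZero p _
  obtain ⟨L, hL⟩ := jl_witt n F p H hord
  obtain ⟨ρ, hρ⟩ := jl_toComplex n L hL
  obtain ⟨A, hA, hc, hi⟩ := hJordan ρ.range (Set.finite_range ρ)
  refine ⟨A.comap ρ.rangeRestrict, hA.comap _, fun x hx y hy => ?_, ?_⟩
  · have := hc _ hx _ hy
    rw [← map_mul, ← map_mul] at this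
    exact hρ (congrArg Subtype.val this)
  · rwa [Subgroup.index_comap_of_surjective _ ρ.rangeRestrict_surjective]
end

section
/- Let n ≥ 0, F a field, H a finite subgroup of GL_n(F), and G a quotient of H. Assume that |G| is prime to the characteristic of F if char F ≠ 0. Then G contains an abelian normal subgroup of index at most d(n), where d(n) is a Jordan bound for GL_n(ℂ). -/
open Finset

theorem lift_step {A B H : Type*} [Ring A] [Ring B] [Group H] [Finite H] (π : A →+* B)
    (hπ : Function.Surjective π) (hsq : ∀ x y, π x = 0 → π y = 0 → x * y = 0)
    (hu : IsUnit ((Nat.card H : ℕ) : A)) (ρ : H →* B) :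
    ∃ ρ' : H →* A, ∀ h, π (ρ' h) = ρ h := by
  classical
  have := Fintype.ofFinite H
  choose s hs using hπ
  obtain ⟨u, hu⟩ := hu
  set φ : H → A := fun g => s (ρ g) with hφ
  have hφ' : ∀ g, π (φ g) = ρ g := fun g => hs _
  set ε : H → H → A := fun g h => φ g * φ h - φ (g * h) with hε
  have hε0 : ∀ g h, π (ε g h) = 0 := fun g h => by simp [hε, hφ']
  have hker : ∀ x y, π x = 0 → π y = 1 → x * y = x := by
    intro x y hx hy
    have := hsq x (y - 1) hx (by simp [hy])
    rwa [mul_sub, mul_one, sub_eq_zero] at this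
  have hcomm : ∀ x : A, (↑u⁻¹ : A) * x = x * ↑u⁻¹ := by
    intro x
    have h : Commute (u : A) x := by rw [hu]; exact Nat.cast_commute _ _
    exact (h.units_inv_left).eq
  set δ : H → A := fun g => (↑u⁻¹ : A) * ∑ h, ε g h * φ h⁻¹ with hδ
  have hδ0 : ∀ g, π (δ g) = 0 := fun g => by simp [hδ, hε0]
  have key : ∀ g k, φ g * δ k + δ g * φ k = δ (g * k) + ε g k := by
    intro g k
    have h1 : δ g * φ k = (↑u⁻¹ : A) * ∑ h, ε g (k * h) * φ h⁻¹ := by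
      simp only [hδ, mul_assoc]
      congr 1
      rw [Finset.sum_mul, ← Equiv.sum_comp (Equiv.mulLeft k)]
      refine Finset.sum_congr rfl fun h _ => ?_
      have hz := hsq (ε g (k * h)) (φ (k * h)⁻¹ * φ k - φ h⁻¹) (hε0 _ _) (by
        rw [map_sub, map_mul, hφ', hφ', hφ', ← map_mul]; simp)
      rw [mul_sub, sub_eq_zero] at hz
      simpa [mul_assoc] using hz
    have h2 : ε g k = (↑u⁻¹ : A) * ∑ h, ε g k * φ h * φ h⁻¹ := by
      have : ∀ h, ε g k * φ h * φ h⁻¹ = ε g k := fun h => by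
        rw [mul_assoc]; exact hker _ _ (hε0 _ _) (by
          rw [map_mul, hφ', hφ', ← map_mul]; simp)
      simp only [this, Finset.sum_const, Finset.card_univ, nsmul_eq_mul, ← Nat.card_eq_fintype_card]
      rw [← mul_assoc, ← hu]; simp
    have h3 : φ g * δ k = (↑u⁻¹ : A) * ∑ h, φ g * ε k h * φ h⁻¹ := by
      simp only [hδ]
      rw [← mul_assoc, ← hcomm, mul_assoc, Finset.mul_sum]
      simp only [mul_assoc]
    rw [h1, h3]
    conv_rhs => rw [h2]
    simp only [hδ]
    rw [← mul_add, ← mul_add, ← Finset.sum_add_distrib, ← Finset.sum_add_distrib]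
    congr 1
    refine Finset.sum_congr rfl fun h _ => ?_
    rw [← add_mul, ← add_mul]
    congr 1
    simp only [hε, mul_assoc]
    noncomm_ring
  have hmul : ∀ g k, (φ g - δ g) * (φ k - δ k) = φ (g * k) - δ (g * k) := by
    intro g k
    have e1 : (φ g - δ g) * (φ k - δ k) =
      φ g * φ k - (φ g * δ k + δ g * φ k) + δ g * δ k := by noncomm_ring
    rw [e1, key, hsq _ _ (hδ0 g) (hδ0 k)]
    simp only [hε]
    abel
  have hone : φ 1 - δ 1 = 1 := by
    have h1 := hmul 1 1
    rw [mul_one] at h1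
    have h2 := hsq (1 - (φ 1 - δ 1)) (1 - (φ 1 - δ 1)) (by simp [hφ', hδ0]) (by simp [hφ', hδ0])
    generalize φ 1 - δ 1 = e at h1 h2
    have h3 : (1 - e) * (1 - e) = 1 - e - e + e * e := by noncomm_ring
    rw [h3, h1] at h2
    simp only [sub_add_cancel] at h2
    exact (sub_eq_zero.mp h2).symm
  exact ⟨⟨⟨fun g => φ g - δ g, hone⟩, fun g k => (hmul g k).symm⟩, fun h => by simp [hφ', hδ0]⟩

theorem frattini_red (p : ℕ) [Fact p.Prime] {G : Type*} [Group G] [Finite G]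
    (hG : ¬ p ∣ Nat.card G) : ∀ (c : ℕ) {H : Type*} [Group H] [Finite H] (f : H →* G)
    (_ : Function.Surjective f) (_ : Nat.card H = c),
    ∃ T : Subgroup H, T.map f = ⊤ ∧ ¬ p ∣ Nat.card T := by
  intro c
  induction c using Nat.strong_induction_on with
  | _ c ih =>
  intro H _ _ f hf hc
  obtain ⟨P⟩ : Nonempty (Sylow p f.ker) := inferInstance
  set Q : Subgroup H := (P : Subgroup f.ker).map f.ker.subtype with hQ
  have hsup : Subgroup.normalizer (Q : Set H) ⊔ f.ker = ⊤ := Sylow.normalizer_sup_eq_top P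
  have hQker : Q ≤ f.ker := Subgroup.map_subtype_le _
  by_cases hN : Subgroup.normalizer (Q : Set H) = ⊤
  · have hQn : Q.Normal := Subgroup.normalizer_eq_top_iff.mp hN
    have hidx : ¬ p ∣ Q.index := by
      rw [← Subgroup.relIndex_mul_index hQker, (Fact.out : p.Prime).dvd_mul, not_or]
      constructor
      · have : Q.relIndex f.ker = (P : Subgroup f.ker).index := by
          rw [Subgroup.relIndex, hQ, Subgroup.subgroupOf, Subgroup.comap_map_eq_self_of_injective (Subgroup.subtype_injective _)]
        rw [this]
        exact P.not_dvd_index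
      · rwa [Subgroup.index_ker, MonoidHom.range_eq_top.mpr hf, Subgroup.card_top]
    have hcard : ∃ a, Nat.card Q = p ^ a := by
      have hp : IsPGroup p Q := P.isPGroup'.map _
      exact IsPGroup.iff_card.mp hp
    obtain ⟨a, ha⟩ := hcard
    have hcop : Nat.Coprime (Nat.card Q) Q.index := by
      rw [ha]
      exact Nat.Coprime.pow_left _ (((Fact.out : p.Prime).coprime_iff_not_dvd).mpr hidx)
    obtain ⟨K, hK⟩ := Subgroup.exists_right_complement'_of_coprime hcop
    refine ⟨K, ?_, ?_⟩
    · have h1 : Q ⊔ K = ⊤ := hK.sup_eq_top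
      have h2 := congrArg (Subgroup.map f) h1
      rw [Subgroup.map_sup, (Subgroup.map_eq_bot_iff _).mpr hQker, bot_sup_eq,
        Subgroup.map_top_of_surjective f hf] at h2
      exact h2
    · rwa [← hK.symm.index_eq_card] 
  · have h2 := congrArg (Subgroup.map f) hsup
    rw [Subgroup.map_sup, (Subgroup.map_eq_bot_iff (f := f) f.ker).mpr le_rfl, sup_bot_eq,
        Subgroup.map_top_of_surjective f hf] at h2
    set M := Subgroup.normalizer (Q : Set H)
    have hlt : Nat.card M < c := by
      rw [← hc]
      refine lt_of_le_of_ne (Subgroup.card_le_card_group M) fun h => hN (Subgroup.eq_top_of_card_eq M h)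
    have hs : Function.Surjective (f.comp M.subtype) := by
      rw [← MonoidHom.range_eq_top, MonoidHom.range_comp, Subgroup.range_subtype, h2]
    obtain ⟨T, hT, hT'⟩ := ih _ hlt (f.comp M.subtype) hs rfl
    refine ⟨T.map M.subtype, by rw [Subgroup.map_map, hT], ?_⟩
    rwa [Subgroup.card_map_of_injective (Subgroup.subtype_injective _)]

theorem exists_hom_complex (A : Type*) [CommRing A] [Nontrivial A] [Algebra ℚ A]
    [hft : Algebra.FiniteType ℚ A] : Nonempty (A →+* ℂ) := by
  obtain ⟨M, hM⟩ := Ideal.exists_maximal A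
  let _ : Field (A ⧸ M) := Ideal.Quotient.field M
  have hft' : Algebra.FiniteType ℚ (A ⧸ M) :=
    hft.of_surjective (Ideal.Quotient.mkₐ ℚ M) (Ideal.Quotient.mkₐ_surjective ℚ M)
  have hfin : Module.Finite ℚ (A ⧸ M) := finite_of_finite_type_of_isJacobsonRing ℚ (A ⧸ M)
  let θ₀ : (A ⧸ M) →ₐ[ℚ] ℂ := IsAlgClosed.lift
  exact ⟨θ₀.toRingHom.comp (Ideal.Quotient.mk M)⟩

theorem char_zero_field {L H : Type*} [Field L] [CharZero L] [Group H] [Finite H] (n : ℕ)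
    (ρ : H →* Matrix (Fin n) (Fin n) L) (hρ : Function.Injective ρ) :
    ∃ σ : H →* Matrix (Fin n) (Fin n) ℂ, Function.Injective σ := by
  classical
  set S : Set L := Set.range (fun x : H × Fin n × Fin n => ρ x.1 x.2.1 x.2.2) ∪
    Set.range (fun x : H × Fin n × Fin n => ((ρ x.1 - 1) x.2.1 x.2.2)⁻¹) with hS
  have hSf : S.Finite := (Set.finite_range _).union (Set.finite_range _)
  set A : Subalgebra ℚ L := Algebra.adjoin ℚ S with hA
  have hft : Algebra.FiniteType ℚ A :=
    (Subalgebra.fg_iff_finiteType A).mp (Subalgebra.fg_def.mpr ⟨S, hSf, rfl⟩)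
  obtain ⟨θ⟩ := exists_hom_complex A
  have hmem : ∀ h i j, ρ h i j ∈ A := fun h i j =>
    Algebra.subset_adjoin (Or.inl ⟨(h, i, j), rfl⟩)
  have hmem' : ∀ h i j, ((ρ h - 1) i j)⁻¹ ∈ A := fun h i j =>
    Algebra.subset_adjoin (Or.inr ⟨(h, i, j), rfl⟩)
  let τ : H → Matrix (Fin n) (Fin n) A := fun h => Matrix.of fun i j => ⟨ρ h i j, hmem h i j⟩
  have hinj : Function.Injective (A.val.toRingHom.mapMatrix (m := Fin n)) := by
    intro x y hxy
    ext i j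
    exact congrFun (congrFun hxy i) j
  have hτ : ∀ h, A.val.toRingHom.mapMatrix (τ h) = ρ h := fun h => by
    ext i j; rfl
  let τ' : H →* Matrix (Fin n) (Fin n) A :=
    { toFun := τ
      map_one' := hinj (by rw [hτ, map_one, map_one])
      map_mul' := fun a b => hinj (by rw [map_mul, hτ, hτ, hτ, map_mul]) }
  refine ⟨θ.mapMatrix.toMonoidHom.comp τ', ?_⟩
  rw [injective_iff_map_eq_one]
  intro g hg
  by_contra hg1
  have hne : ρ g - 1 ≠ 0 := fun h => hg1 (hρ (by rw [sub_eq_zero.mp h, map_one]))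
  obtain ⟨i, j, hij⟩ : ∃ i j, (ρ g - 1) i j ≠ 0 := by
    by_contra! h
    exact hne (by ext i j; exact h i j)
  have h1 : θ.mapMatrix (τ' g - 1) = 0 := by
    rw [map_sub, map_one, sub_eq_zero]; exact hg
  have h2 : θ ((τ' g - 1) i j) = 0 := congrFun (congrFun h1 i) j
  have h3 : (τ' g - 1) i j * ⟨((ρ g - 1) i j)⁻¹, hmem' g i j⟩ = 1 := by
    have h4 : A.val.toRingHom ((τ' g - 1) i j) = (ρ g - 1) i j := by
      have : A.val.toRingHom.mapMatrix (τ' g - 1) = ρ g - 1 := by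
        rw [map_sub, map_one]; congr 1
      exact congrFun (congrFun this i) j
    apply Subtype.ext
    change A.val.toRingHom ((τ' g - 1) i j) * ((ρ g - 1) i j)⁻¹ = 1
    rw [h4, mul_inv_cancel₀ hij]
  have h5 := congrArg θ h3
  rw [map_mul, h2, zero_mul, map_one] at h5
  exact zero_ne_one h5

theorem char_zero_ring {R H : Type*} [CommRing R] [CharZero R] [Group H] [Finite H] (n : ℕ)
    (ρ : H →* Matrix (Fin n) (Fin n) R) (hρ : ∀ g ≠ 1, ∃ i j, IsUnit ((ρ g - 1) i j)) :
    ∃ σ : H →* Matrix (Fin n) (Fin n) ℂ, Function.Injective σ := by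
  classical
  let T : Submonoid R := (nonZeroDivisors ℤ).map (Int.castRingHom R)
  have hdis : Disjoint ((⊥ : Ideal R) : Set R) (T : Set R) := by
    rw [Set.disjoint_left]
    rintro x hx ⟨z, hz, rfl⟩
    have hx' : (z : R) = 0 := by simpa using hx
    exact nonZeroDivisors.ne_zero hz (by exact_mod_cast hx')
  obtain ⟨P, hP, -, hPT⟩ := Ideal.exists_le_prime_disjoint _ _ hdis
  let L := FractionRing (R ⧸ P)
  let q : R →+* L := (algebraMap (R ⧸ P) L).comp (Ideal.Quotient.mk P)
  have hq : ∀ x, q x = 0 → x ∈ P := fun x hx => by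
    have : Ideal.Quotient.mk P x = 0 :=
      IsFractionRing.injective (R ⧸ P) L (by rw [map_zero]; exact hx)
    exact Ideal.Quotient.eq_zero_iff_mem.mp this
  have hchar : CharZero L := charZero_of_inj_zero fun m hm => by
    by_contra hm0
    have h1 : (m : R) ∈ P := hq _ (by rw [map_natCast, hm])
    exact Set.disjoint_left.mp hPT h1 ⟨(m : ℤ), mem_nonZeroDivisors_of_ne_zero (by exact_mod_cast hm0), by simp⟩
  refine char_zero_field n (q.mapMatrix.toMonoidHom.comp ρ) ?_
  rw [injective_iff_map_eq_one]
  intro g hg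
  by_contra hg1
  obtain ⟨i, j, hij⟩ := hρ g hg1
  have h1 : q.mapMatrix (ρ g - 1) = 0 := by
    rw [map_sub, map_one, sub_eq_zero]; exact hg
  have h2 : q ((ρ g - 1) i j) = 0 := congrFun (congrFun h1 i) j
  exact (hij.map q).ne_zero h2

theorem lift_abstract (p : ℕ) {W k H : Type*} [CommRing W] [Field k] [CharP k p]
    [Group H] [Finite H] (n : ℕ) (hH : ¬ p ∣ Nat.card H)
    (κ : W →+* k) (hκ : Function.Surjective κ) (hκk : RingHom.ker κ = Ideal.span {(p : W)})
    (hκu : ∀ w, κ w ≠ 0 → IsUnit w)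
    (hsep : ∀ z : ℕ, z ≠ 0 → ∃ e : ℕ, (z : W) ∉ Ideal.span {(p ^ (e + 1) : W)})
    (ρ : H →* Matrix (Fin n) (Fin n) k) (hρ : Function.Injective ρ) :
    ∃ σ : H →* Matrix (Fin n) (Fin n) ℂ, Function.Injective σ := by
  classical
  let I : ℕ → Ideal W := fun m => Ideal.span {(p ^ (m + 1) : W)}
  have hI : ∀ m, ∀ a ∈ I m, κ a = 0 := by
    intro m a ha
    obtain ⟨b, rfl⟩ := Ideal.mem_span_singleton.mp ha
    have : κ (p : W) = 0 := by rw [map_natCast]; exact CharP.cast_eq_zero k p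
    rw [map_mul, map_pow, this]; simp
  let c : ∀ m, (W ⧸ I m) →+* k := fun m => Ideal.Quotient.lift (I m) κ (hI m)
  have hunit : ∀ m x, c m x ≠ 0 → IsUnit x := by
    intro m x hx
    obtain ⟨w, rfl⟩ := Ideal.Quotient.mk_surjective x
    exact (hκu w hx).map _
  have hHk : (Nat.card H : k) ≠ 0 := fun h => hH ((CharP.cast_eq_zero_iff k p _).mp h)
  have hcardu : ∀ m, IsUnit ((Nat.card H : ℕ) : Matrix (Fin n) (Fin n) (W ⧸ I m)) := by
    intro m
    have : IsUnit ((Nat.card H : ℕ) : W ⧸ I m) := hunit m _ (by rwa [map_natCast])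
    have h2 := this.map (algebraMap (W ⧸ I m) (Matrix (Fin n) (Fin n) (W ⧸ I m)))
    rwa [map_natCast] at h2
  have hlift : ∀ m, ∃ τ : H →* Matrix (Fin n) (Fin n) (W ⧸ I m),
      ∀ h, (c m).mapMatrix (τ h) = ρ h := by
    intro m
    induction m with
    | zero =>
      refine lift_step (c 0).mapMatrix ?_ ?_ (hcardu 0) ρ
      · intro y
        have hs : Function.Surjective (c 0) :=
          Ideal.Quotient.lift_surjective_of_surjective _ _ hκ
        choose s hs using hs
        exact ⟨y.map s, by ext i j; simp [hs]⟩
      · intro x y hx hy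
        have hx0 : x = 0 := by
          ext i j
          have h1 : c 0 (x i j) = 0 := congrFun (congrFun hx i) j
          obtain ⟨w, hw⟩ := Ideal.Quotient.mk_surjective (x i j)
          rw [← hw] at h1 ⊢
          refine Ideal.Quotient.eq_zero_iff_mem.mpr ?_
          have h2 : w ∈ RingHom.ker κ := h1
          rw [hκk] at h2
          simpa [I] using h2
        rw [hx0, zero_mul]
    | succ m ih =>
      obtain ⟨τ, hτ⟩ := ih
      have hle : I (m + 1) ≤ I m := by
        refine Ideal.span_singleton_le_span_singleton.mpr (pow_dvd_pow _ (by omega))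
      let t : (W ⧸ I (m + 1)) →+* (W ⧸ I m) := Ideal.Quotient.factor hle
      have ht : Function.Surjective t := Ideal.Quotient.factor_surjective hle
      have hker : ∀ a b, t a = 0 → t b = 0 → a * b = 0 := by
        intro a b ha hb
        obtain ⟨a, rfl⟩ := Ideal.Quotient.mk_surjective a
        obtain ⟨b, rfl⟩ := Ideal.Quotient.mk_surjective b
        have ha' : a ∈ I m := Ideal.Quotient.eq_zero_iff_mem.mp ha
        have hb' : b ∈ I m := Ideal.Quotient.eq_zero_iff_mem.mp hb
        obtain ⟨a', rfl⟩ := Ideal.mem_span_singleton.mp ha'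
        obtain ⟨b', rfl⟩ := Ideal.mem_span_singleton.mp hb'
        rw [← map_mul]
        refine Ideal.Quotient.eq_zero_iff_mem.mpr (Ideal.mem_span_singleton.mpr ?_)
        exact ⟨p ^ m * a' * b', by ring⟩
      obtain ⟨τ', hτ'⟩ := lift_step t.mapMatrix (by
        intro y
        choose s hs using ht
        exact ⟨y.map s, by ext i j; simp [hs]⟩) (by
        intro x y hx hy
        ext i j
        rw [Matrix.mul_apply, Matrix.zero_apply]
        exact Finset.sum_eq_zero fun l _ => hker _ _ (congrFun (congrFun hx i) l)
          (congrFun (congrFun hy l) j)) (hcardu (m + 1)) τ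
      refine ⟨τ', fun h => ?_⟩
      rw [← hτ, ← hτ']
      have hc : c (m + 1) = (c m).comp t := by
        apply Ideal.Quotient.ringHom_ext
        ext x : 1
        rfl
      rw [hc]
      ext i j
      rfl
  choose τ hτ using hlift
  have hR : CharZero (∀ m, W ⧸ I m) := by
    refine charZero_of_inj_zero fun z hz => ?_
    by_contra hz0
    obtain ⟨e, he⟩ := hsep z hz0
    have h1 : ((z : W ⧸ I e)) = 0 := congrFun hz e
    exact he (Ideal.Quotient.eq_zero_iff_mem.mp (by rw [map_natCast]; exact h1))
  let T : H →* Matrix (Fin n) (Fin n) (∀ m, W ⧸ I m) :=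
    { toFun := fun h => Matrix.of fun i j m => τ m h i j
      map_one' := by
        ext i j m
        have : (τ m 1) i j = (1 : Matrix (Fin n) (Fin n) (W ⧸ I m)) i j := by rw [map_one]
        simp only [Matrix.of_apply, this, Matrix.one_apply]
        split_ifs <;> rfl
      map_mul' := fun a b => by
        ext i j m
        have : (τ m (a * b)) i j = (τ m a * τ m b) i j := by rw [map_mul]
        simp only [Matrix.of_apply, this, Matrix.mul_apply, Finset.sum_apply, Pi.mul_apply] }
  refine char_zero_ring n T fun g hg => ?_
  have hne : ρ g - 1 ≠ 0 := fun h => hg (hρ (by rw [sub_eq_zero.mp h, map_one]))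
  obtain ⟨i, j, hij⟩ : ∃ i j, (ρ g - 1) i j ≠ 0 := by
    by_contra! h
    exact hne (by ext i j; exact h i j)
  refine ⟨i, j, Pi.isUnit_iff.mpr fun m => hunit m _ ?_⟩
  have h1 : (T g - 1) i j m = (τ m g - 1) i j := by
    simp only [Matrix.sub_apply, Pi.sub_apply, Matrix.one_apply]
    congr 1
    split_ifs <;> rfl
  have h2 : (c m).mapMatrix (τ m g - 1) = ρ g - 1 := by rw [map_sub, map_one, hτ]
  rw [h1]
  have h3 : c m ((τ m g - 1) i j) = (ρ g - 1) i j := congrFun (congrFun h2 i) j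
  rwa [h3]

open WittVector in
theorem char_p_lift (p : ℕ) [Fact p.Prime] {k H : Type*} [Field k] [CharP k p] [PerfectRing k p]
    [Group H] [Finite H] (n : ℕ) (hH : ¬ p ∣ Nat.card H)
    (ρ : H →* Matrix (Fin n) (Fin n) k) (hρ : Function.Injective ρ) :
    ∃ σ : H →* Matrix (Fin n) (Fin n) ℂ, Function.Injective σ := by
  have hW0 : CharZero (WittVector p k) := by
    refine charZero_of_inj_zero fun z hz => ?_
    by_contra hz0
    obtain ⟨e, z', hz', rfl⟩ := Nat.exists_eq_pow_mul_and_not_dvd hz0 p (Fact.out : p.Prime).ne_one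
    rw [Nat.cast_mul, Nat.cast_pow, mul_eq_zero] at hz
    rcases hz with hz | hz
    · exact p_nonzero p k (eq_zero_of_pow_eq_zero hz)
    · have := congrArg (constantCoeff : WittVector p k →+* k) hz
      rw [map_natCast, map_zero] at this
      exact hz' ((CharP.cast_eq_zero_iff k p _).mp this)
  refine lift_abstract p n hH (constantCoeff : WittVector p k →+* k)
    (fun a => ⟨teichmuller p a, by simp [constantCoeff]⟩) ker_constantCoeff
    isUnit_of_coeff_zero_ne_zero (fun z hz0 => ?_) ρ hρ
  have hzW : (z : WittVector p k) ≠ 0 := Nat.cast_ne_zero.mpr hz0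
  obtain ⟨e, b, hb, he⟩ := exists_eq_pow_p_mul (p := p) (k := k) z hzW
  refine ⟨e, fun h2 => ?_⟩
  obtain ⟨b', hb'⟩ := Ideal.mem_span_singleton.mp h2
  rw [he, pow_succ, mul_assoc] at hb'
  have h3 : b = p * b' := mul_left_cancel₀ (pow_ne_zero e (p_nonzero p k)) hb'
  apply hb
  rw [h3, mul_comm]
  exact mul_charP_coeff_zero _

theorem finish (n d : ℕ)
    (hJordan : ∀ K : Subgroup (Matrix.GeneralLinearGroup (Fin n) ℂ), Finite K →
      ∃ A : Subgroup K, A.Normal ∧ (∀ x ∈ A, ∀ y ∈ A, x * y = y * x) ∧ A.index ≤ d)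
    {H G : Type*} [Group H] [Finite H] [Group G] (f : H →* G) (hf : Function.Surjective f)
    (σ : H →* Matrix (Fin n) (Fin n) ℂ) (hσ : Function.Injective σ) :
    ∃ A : Subgroup G, A.Normal ∧ (∀ x ∈ A, ∀ y ∈ A, x * y = y * x) ∧ A.index ≤ d := by
  have hinj : Function.Injective σ.toHomUnits := fun a b h =>
    hσ (by simpa using congrArg Units.val h)
  let σ' : H →* Matrix.GeneralLinearGroup (Fin n) ℂ := σ.toHomUnits
  let e : H ≃* σ'.range := MonoidHom.ofInjective hinj
  have hfin : Finite σ'.range := Finite.of_equiv H e.toEquiv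
  obtain ⟨A, hA, hc, hd⟩ := hJordan σ'.range hfin
  let g : σ'.range →* G := f.comp e.symm.toMonoidHom
  have hg : Function.Surjective g := hf.comp e.symm.surjective
  refine ⟨A.map g, hA.map g hg, ?_, ?_⟩
  · rintro _ ⟨x, hx, rfl⟩ _ ⟨y, hy, rfl⟩
    rw [← map_mul, hc x hx y hy, map_mul]
  · exact (Nat.le_of_dvd (Nat.pos_of_ne_zero A.index_ne_zero_of_finite) (A.index_map_dvd hg)).trans hd

/-- Serre's Theorem 3′: let `d` be a Jordan bound for `GL_n(ℂ)`. If `H ≤ GL_n(F)` is a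
finite subgroup and `G` a quotient of `H` whose order is prime to the characteristic of
`F` when the latter is nonzero, then `G` has an abelian normal subgroup of index ≤ `d`. -/
theorem stmt_10 (n : ℕ) (d : ℕ)
    (hJordan : ∀ K : Subgroup (Matrix.GeneralLinearGroup (Fin n) ℂ), Finite K →
      ∃ A : Subgroup K, A.Normal ∧ (∀ x ∈ A, ∀ y ∈ A, x * y = y * x) ∧ A.index ≤ d)
    (F : Type*) [Field F]
    (H : Subgroup (Matrix.GeneralLinearGroup (Fin n) F)) [Finite H]
    (G : Type*) [Group G] [Finite G] (f : H →* G) (hf : Function.Surjective f)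
    (hord : ∀ p : ℕ, p.Prime → CharP F p → ¬ p ∣ Nat.card G) :
    ∃ A : Subgroup G, A.Normal ∧ (∀ x ∈ A, ∀ y ∈ A, x * y = y * x) ∧ A.index ≤ d := by
  let ρ : H →* Matrix (Fin n) (Fin n) F := (Units.coeHom _).comp H.subtype
  have hρ : Function.Injective ρ := Units.val_injective.comp Subtype.val_injective
  obtain ⟨p, hp⟩ := CharP.exists F
  rcases CharP.char_is_prime_or_zero F p with hpp | rfl
  · have : Fact p.Prime := ⟨hpp⟩
    obtain ⟨T, hT, hTp⟩ := frattini_red p (hord p hpp hp) _ f hf rfl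
    let k := AlgebraicClosure F
    have : CharP k p := charP_of_injective_algebraMap (algebraMap F k).injective p
    let ρ' : T →* Matrix (Fin n) (Fin n) k :=
      (algebraMap F k).mapMatrix.toMonoidHom.comp (ρ.comp T.subtype)
    have hρ' : Function.Injective ρ' := by
      have : Function.Injective ((algebraMap F k).mapMatrix (m := Fin n)) :=
        Matrix.map_injective (algebraMap F k).injective
      exact this.comp (hρ.comp Subtype.val_injective)
    obtain ⟨σ, hσ⟩ := char_p_lift p n hTp ρ' hρ'
    refine finish n d hJordan (f.comp T.subtype) ?_ σ hσ
    rw [← MonoidHom.range_eq_top, MonoidHom.range_comp, Subgroup.range_subtype, hT]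
  · have : CharZero F := CharP.charP_to_charZero F
    obtain ⟨σ, hσ⟩ := char_zero_field n ρ hρ
    exact finish n d hJordan f hf σ hσ
end
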